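/- arXiv:2512.24956 — 8 statements merged into one kernel-verified Lean document; each statement's English description precedes it below -/
import Mathlib

section
/- Let d be a positive integer and let ρ and σ be d×d positive definite Hermitian complex matrices with Tr ρ = Tr σ = 1. Suppose X : (0,1) → (d×d complex matrices) satisfies, for every λ ∈ (0,1), the equation (1−λ)·ρ·X(λ) + λ·X(λ)·σ = ρ − σ. Then the quantum relative entropy admits the integral representation D(ρ‖σ) = ∫₀¹ λ · Tr[(ρ−σ)·X(λ)] dλ, where the integrand is real for each λ. -/
open Matrix MeasureTheory
open scoped ComplexOrder

/-- Matrix logarithm of a Hermitian positive definite matrix via the spectral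
decomposition (continuous functional calculus); junk value `0` otherwise. -/
noncomputable def matLog {n : Type*} [Fintype n] [DecidableEq n]
    (A : Matrix n n ℂ) : Matrix n n ℂ :=
  if hA : A.IsHermitian then
    (hA.eigenvectorUnitary : Matrix n n ℂ) *
      Matrix.diagonal (fun i => (Real.log (hA.eigenvalues i) : ℂ)) *
      (star (hA.eigenvectorUnitary : Matrix n n ℂ))
  else 0

/-- Quantum relative entropy `D(ρ‖σ) = Re Tr[ρ (log ρ − log σ)]`. -/
noncomputable def qRelEnt {n : Type*} [Fintype n] [DecidableEq n]
    (ρ σ : Matrix n n ℂ) : ℝ :=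
  (Matrix.trace (ρ * (matLog ρ - matLog σ))).re

open Set

section Overlap

variable {n : Type*} [Fintype n] [DecidableEq n]

lemma trace_conj_diagonal_mul_conj_diagonal (U V : Matrix n n ℂ) (a b : n → ℝ) :
    trace ((U * diagonal (fun i => (a i : ℂ)) * star U) *
        (V * diagonal (fun j => (b j : ℂ)) * star V)) =
      ((∑ i, ∑ j, a i * b j * Complex.normSq ((star U * V) i j) : ℝ) : ℂ) := by
  have h : trace ((U * diagonal (fun i => (a i : ℂ)) * star U) *
        (V * diagonal (fun j => (b j : ℂ)) * star V)) =
      trace ((diagonal (fun i => (a i : ℂ)) * (star U * V)) *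
        (diagonal (fun j => (b j : ℂ)) * star (star U * V))) := by
    rw [Matrix.mul_assoc U, Matrix.mul_assoc U, Matrix.trace_mul_comm U]
    simp only [star_mul, star_star, Matrix.mul_assoc]
  rw [h, trace]
  push_cast
  refine Finset.sum_congr rfl fun i _ => ?_
  rw [diag_apply, Matrix.mul_apply]
  refine Finset.sum_congr rfl fun j _ => ?_
  rw [diagonal_mul, diagonal_mul, star_apply, ← Complex.mul_conj, starRingEnd_apply]
  ring

lemma trace_sub_mul_eq_sum_normSq {U V X : Matrix n n ℂ} (hU : star U * U = 1)
    (hV : star V * V = 1) {r s : n → ℝ} (hr : ∀ i, 0 < r i) (hs : ∀ j, 0 < s j)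
    {t : ℝ} (ht : t ∈ Ioo (0 : ℝ) 1)
    (hX : (1 - t) • ((U * diagonal (fun i => (r i : ℂ)) * star U) * X) +
        t • (X * (V * diagonal (fun j => (s j : ℂ)) * star V)) =
      U * diagonal (fun i => (r i : ℂ)) * star U - V * diagonal (fun j => (s j : ℂ)) * star V) :
    trace ((U * diagonal (fun i => (r i : ℂ)) * star U -
        V * diagonal (fun j => (s j : ℂ)) * star V) * X) =
      ((∑ i, ∑ j, (r i - s j) ^ 2 / ((1 - t) * r i + t * s j) *
        Complex.normSq ((star U * V) i j) : ℝ) : ℂ) := by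
  set R := diagonal (fun i => (r i : ℂ)) with hR
  set S := diagonal (fun j => (s j : ℂ)) with hS
  set W := star U * V with hW
  set Y := star U * X * V with hY
  have hV' : V * star V = 1 := mul_eq_one_comm.mp hV
  have hU' : U * star U = 1 := mul_eq_one_comm.mp hU
  have cU (M : Matrix n n ℂ) : star U * (U * M) = M := by
    rw [← Matrix.mul_assoc, hU, Matrix.one_mul]
  have cU' (M : Matrix n n ℂ) : U * (star U * M) = M := by
    rw [← Matrix.mul_assoc, hU', Matrix.one_mul]
  have cV (M : Matrix n n ℂ) : star V * (V * M) = M := by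
    rw [← Matrix.mul_assoc, hV, Matrix.one_mul]
  have hYeq : (1 - t) • (R * Y) + t • (Y * S) = R * W - W * S := by
    have := congrArg (fun M => star U * M * V) hX
    simpa only [hY, hW, Matrix.mul_add, Matrix.add_mul, Matrix.mul_sub, Matrix.sub_mul,
      Matrix.mul_smul, Matrix.smul_mul, Matrix.mul_assoc, cU, hV, Matrix.mul_one] using this
  have hXY : X = U * Y * star V := by
    simp only [hY, Matrix.mul_assoc, cU', hV', Matrix.mul_one]
  have htr : trace ((U * R * star U - V * S * star V) * X) =
      trace (Y * (star W * R - S * star W)) := by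
    rw [hXY, ← Matrix.mul_assoc, Matrix.trace_mul_comm, Matrix.trace_mul_comm Y]
    simp only [hW, star_mul, star_star, Matrix.mul_sub, Matrix.sub_mul, Matrix.mul_assoc, cU, cV]
  rw [htr, trace]
  push_cast
  refine Finset.sum_congr rfl fun i _ => ?_
  rw [diag_apply, Matrix.mul_apply]
  refine Finset.sum_congr rfl fun j _ => ?_
  have hm : (0 : ℝ) < (1 - t) * r i + t * s j :=
    add_pos (mul_pos (sub_pos.mpr ht.2) (hr i)) (mul_pos ht.1 (hs j))
  have hm' : (1 - (t : ℂ)) * r i + t * s j ≠ 0 := by exact_mod_cast hm.ne'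
  have hij := congrFun (congrFun hYeq i) j
  simp only [hR, hS, Matrix.add_apply, Matrix.sub_apply, Matrix.smul_apply, diagonal_mul,
    mul_diagonal, Complex.real_smul] at hij
  push_cast at hij
  rw [Matrix.sub_apply, hR, hS, mul_diagonal, diagonal_mul, star_apply, ← Complex.mul_conj,
    starRingEnd_apply, div_mul_eq_mul_div, eq_div_iff hm']
  linear_combination ((r i : ℂ) - s j) * star (W i j) * hij

end Overlap

lemma hasDerivAt_relEntropy_primitive {a b t : ℝ} (hm : 0 < (1 - t) * a + t * b) :
    HasDerivAt (fun x => -(a * Real.log ((1 - x) * a + x * b)) - (a - b) * x)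
      (t * ((a - b) ^ 2 / ((1 - t) * a + t * b))) t := by
  have h1 : HasDerivAt (fun x : ℝ => (1 - x) * a + x * b) (-1 * a + 1 * b) t :=
    (((hasDerivAt_id t).const_sub 1).mul_const a).add ((hasDerivAt_id t).mul_const b)
  refine (((h1.log hm.ne').const_mul a).neg.sub
    ((hasDerivAt_id t).const_mul (a - b))).congr_deriv ?_
  have hne : (1 - t) * a + t * b ≠ 0 := hm.ne'
  change -(a * ((-1 * a + 1 * b) / ((1 - t) * a + t * b))) - (a - b) * 1 = _
  rw [← mul_div_assoc, ← mul_div_assoc, ← neg_div, div_sub' hne]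
  ring

lemma convexComb_pos_of_mem_uIcc {a b t : ℝ} (ha : 0 < a) (hb : 0 < b)
    (ht : t ∈ uIcc (0 : ℝ) 1) : 0 < (1 - t) * a + t * b := by
  rw [uIcc_of_le zero_le_one] at ht
  rcases ht.1.eq_or_lt with h | h
  · simpa [← h] using ha
  · exact add_pos_of_nonneg_of_pos (mul_nonneg (sub_nonneg.mpr ht.2) ha.le) (mul_pos h hb)

lemma intervalIntegrable_mul_sq_div {a b : ℝ} (ha : 0 < a) (hb : 0 < b) :
    IntervalIntegrable (fun t => t * ((a - b) ^ 2 / ((1 - t) * a + t * b))) volume 0 1 := by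
  refine ContinuousOn.intervalIntegrable fun t ht => ContinuousAt.continuousWithinAt ?_
  have := (convexComb_pos_of_mem_uIcc ha hb ht).ne'
  fun_prop (disch := assumption)

lemma integral_mul_sq_div {a b : ℝ} (ha : 0 < a) (hb : 0 < b) :
    ∫ t in (0 : ℝ)..1, t * ((a - b) ^ 2 / ((1 - t) * a + t * b)) =
      a * Real.log a - a * Real.log b - a + b := by
  rw [intervalIntegral.integral_eq_sub_of_hasDerivAt
    (fun t ht => hasDerivAt_relEntropy_primitive (convexComb_pos_of_mem_uIcc ha hb ht))
    (intervalIntegrable_mul_sq_div ha hb)]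
  simp only [sub_self, zero_mul, one_mul, zero_add, sub_zero, add_zero, mul_one, mul_zero]
  ring

lemma Matrix.IsHermitian.eq_conj_diagonal {n : Type*} [Fintype n] [DecidableEq n]
    {A : Matrix n n ℂ} (hA : A.IsHermitian) :
    A = (hA.eigenvectorUnitary : Matrix n n ℂ) * diagonal (fun i => (hA.eigenvalues i : ℂ)) *
      star (hA.eigenvectorUnitary : Matrix n n ℂ) := by
  conv_lhs => rw [hA.spectral_theorem]
  rfl

lemma qRelEnt_eq_sum {n : Type*} [Fintype n] [DecidableEq n] {ρ σ : Matrix n n ℂ}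
    (hρ : ρ.IsHermitian) (hσ : σ.IsHermitian) (htr : ρ.trace = σ.trace) :
    qRelEnt ρ σ = ∑ i, ∑ j,
      (hρ.eigenvalues i * Real.log (hρ.eigenvalues i) -
        hρ.eigenvalues i * Real.log (hσ.eigenvalues j) - hρ.eigenvalues i + hσ.eigenvalues j) *
      Complex.normSq ((star (hρ.eigenvectorUnitary : Matrix n n ℂ) *
        (hσ.eigenvectorUnitary : Matrix n n ℂ)) i j) := by
  set U := (hρ.eigenvectorUnitary : Matrix n n ℂ) with hUdef
  set V := (hσ.eigenvectorUnitary : Matrix n n ℂ) with hVdef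
  have hU : star U * U = 1 := Unitary.coe_star_mul_self _
  have hU' : U * star U = 1 := mul_eq_one_comm.mp hU
  have hV' : V * star V = 1 := Unitary.coe_mul_star_self _
  have hρU := hρ.eq_conj_diagonal
  have hσV := hσ.eq_conj_diagonal
  rw [← hUdef] at hρU
  rw [← hVdef] at hσV
  have hlogρ : matLog ρ = U * diagonal (fun i => (Real.log (hρ.eigenvalues i) : ℂ)) * star U := by
    rw [matLog, dif_pos hρ]
  have hlogσ : matLog σ = V * diagonal (fun i => (Real.log (hσ.eigenvalues i) : ℂ)) * star V := by
    rw [matLog, dif_pos hσ]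
  have h1 := trace_conj_diagonal_mul_conj_diagonal U V
    (fun i => hρ.eigenvalues i * Real.log (hρ.eigenvalues i)) (fun _ => 1)
  have h2 := trace_conj_diagonal_mul_conj_diagonal U V hρ.eigenvalues
    (fun j => Real.log (hσ.eigenvalues j))
  have h3 := trace_conj_diagonal_mul_conj_diagonal U V hρ.eigenvalues (fun _ => 1)
  have h4 := trace_conj_diagonal_mul_conj_diagonal U V (fun _ => 1) hσ.eigenvalues
  have hmul : U * diagonal (fun i => ((hρ.eigenvalues i * Real.log (hρ.eigenvalues i) : ℝ) : ℂ)) *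
      star U = ρ * matLog ρ := by
    conv_rhs => rw [hlogρ]; enter [1]; rw [hρU]
    simp only [Matrix.mul_assoc]
    rw [← Matrix.mul_assoc (star U) U, hU, Matrix.one_mul, ← Matrix.mul_assoc (diagonal _),
      diagonal_mul_diagonal]
    simp only [Complex.ofReal_mul]
  simp only [Complex.ofReal_one, diagonal_one, Matrix.mul_one, Matrix.one_mul, hU', hV',
    ← hρU, ← hσV, ← hlogσ, hmul] at h1 h2 h3 h4
  rw [qRelEnt, Matrix.mul_sub, trace_sub, h1, h2, Complex.sub_re, Complex.ofReal_re,
    Complex.ofReal_re]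
  rw [h3, h4, Complex.ofReal_inj] at htr
  rw [← sub_eq_zero, ← sub_eq_zero.mpr htr]
  simp only [← Finset.sum_sub_distrib]
  refine Finset.sum_congr rfl fun i _ => Finset.sum_congr rfl fun j _ => ?_
  ring

/-- Integral representation of the quantum relative entropy in terms of
the `χ²_λ` divergences: if `X λ` solves `(1−λ)ρ·X(λ) + λ·X(λ)·σ = ρ − σ` for every
`λ ∈ (0,1)`, then `D(ρ‖σ) = ∫₀¹ λ · Tr[(ρ−σ)X(λ)] dλ`, the integrand being real. -/
theorem relEntropy_integral_representation
    (d : ℕ) (hd : 0 < d)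
    (ρ σ : Matrix (Fin d) (Fin d) ℂ)
    (hρ : ρ.PosDef) (hσ : σ.PosDef)
    (hρtr : ρ.trace = 1) (hσtr : σ.trace = 1)
    (X : ℝ → Matrix (Fin d) (Fin d) ℂ)
    (hX : ∀ lam ∈ Set.Ioo (0 : ℝ) 1,
      (1 - lam) • (ρ * X lam) + lam • (X lam * σ) = ρ - σ) :
    (∀ lam ∈ Set.Ioo (0 : ℝ) 1, (Matrix.trace ((ρ - σ) * X lam)).im = 0) ∧
      qRelEnt ρ σ = ∫ lam in (0:ℝ)..1, lam * (Matrix.trace ((ρ - σ) * X lam)).re := by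
  set r := hρ.isHermitian.eigenvalues
  set s := hσ.isHermitian.eigenvalues
  set W := star (hρ.isHermitian.eigenvectorUnitary : Matrix (Fin d) (Fin d) ℂ) *
    (hσ.isHermitian.eigenvectorUnitary : Matrix (Fin d) (Fin d) ℂ)
  have hrpos : ∀ i, 0 < r i := hρ.eigenvalues_pos
  have hspos : ∀ j, 0 < s j := hσ.eigenvalues_pos
  have htrace : ∀ t ∈ Ioo (0 : ℝ) 1, trace ((ρ - σ) * X t) =
      ((∑ i, ∑ j, (r i - s j) ^ 2 / ((1 - t) * r i + t * s j) *
        Complex.normSq (W i j) : ℝ) : ℂ) := by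
    intro t ht
    have h := hX t ht
    have key := trace_sub_mul_eq_sum_normSq (X := X t)
      (Unitary.coe_star_mul_self hρ.isHermitian.eigenvectorUnitary)
      (Unitary.coe_star_mul_self hσ.isHermitian.eigenvectorUnitary) hrpos hspos ht
    rw [← hρ.isHermitian.eq_conj_diagonal, ← hσ.isHermitian.eq_conj_diagonal] at key
    exact key h
  refine ⟨fun t ht => by rw [htrace t ht, Complex.ofReal_im], ?_⟩
  have hint : ∫ t in (0:ℝ)..1, t * (trace ((ρ - σ) * X t)).re =
      ∫ t in (0:ℝ)..1, ∑ i, ∑ j, t * ((r i - s j) ^ 2 / ((1 - t) * r i + t * s j)) *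
        Complex.normSq (W i j) := by
    rw [intervalIntegral.integral_of_le zero_le_one, intervalIntegral.integral_of_le zero_le_one,
      integral_Ioc_eq_integral_Ioo, integral_Ioc_eq_integral_Ioo]
    refine setIntegral_congr_fun measurableSet_Ioo fun t ht => ?_
    simp only [htrace t ht, Complex.ofReal_re, Finset.mul_sum, mul_assoc]
  have hii (i j : Fin d) := (intervalIntegrable_mul_sq_div (hrpos i) (hspos j)).mul_const
    (Complex.normSq (W i j))
  have hi (i : Fin d) : IntervalIntegrable (fun t => ∑ j, t * ((r i - s j) ^ 2 /
      ((1 - t) * r i + t * s j)) * Complex.normSq (W i j)) volume 0 1 := by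
    simpa only [Finset.sum_fn] using IntervalIntegrable.sum Finset.univ fun j _ => hii i j
  rw [hint, qRelEnt_eq_sum hρ.isHermitian hσ.isHermitian (hρtr.trans hσtr.symm),
    intervalIntegral.integral_finsetSum fun i _ => hi i]
  refine Finset.sum_congr rfl fun i _ => ?_
  rw [intervalIntegral.integral_finsetSum fun j _ => hii i j]
  refine Finset.sum_congr rfl fun j _ => ?_
  rw [intervalIntegral.integral_mul_const, integral_mul_sq_div (hrpos i) (hspos j)]
end

section
/- Let d be a positive integer, let ρ and σ be d×d positive definite Hermitian complex matrices with Tr ρ = Tr σ = 1, let λ ∈ (0,1), and let Q be a d×d Hermitian matrix. Let X_λ be the unique solution of (1−λ)ρX + λXσ = ρ − σ, set x := Re Tr[(ρ−σ)Q], v := Var_ρ(Q) and w := Var_σ(Q), and assume (1−λ)v + λw + λ(1−λ)x² > 0. Then the quantum Chapman–Robbins bound holds: Re Tr[(ρ−σ)X_λ] ≥ x² / ((1−λ)v + λw + λ(1−λ)x²). -/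
open Matrix
open scoped ComplexOrder

/-- Variance `Var_ρ(Q) := Re Tr[ρ (Q − Re Tr(ρQ)·I)²]` of a Hermitian observable `Q`
in the state `ρ`. -/
noncomputable def qVar {n : Type*} [Fintype n] [DecidableEq n]
    (ρ Q : Matrix n n ℂ) : ℝ :=
  (Matrix.trace (ρ * ((Q - (((Matrix.trace (ρ * Q)).re : ℝ) : ℂ) • 1) *
      (Q - (((Matrix.trace (ρ * Q)).re : ℝ) : ℂ) • 1)))).re

namespace Matrix

variable {n : Type*} [Fintype n]

/-- The real bilinear form `⟪A, B⟫ = Re Tr[A† ((1−l) ρ B + l B σ)]`. -/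
noncomputable def leftRightForm (l : ℝ) (ρ σ A B : Matrix n n ℂ) : ℝ :=
  (trace (Aᴴ * ((1 - l) • (ρ * B) + l • (B * σ)))).re

lemma re_trace_conjTranspose (A : Matrix n n ℂ) : (trace Aᴴ).re = (trace A).re := by
  simp [trace_conjTranspose]

lemma leftRightForm_self_nonneg {l : ℝ} (hl : l ∈ Set.Ioo (0 : ℝ) 1)
    {ρ σ : Matrix n n ℂ} (hρ : ρ.PosSemidef) (hσ : σ.PosSemidef) (A : Matrix n n ℂ) :
    0 ≤ leftRightForm l ρ σ A A := by
  have h₁ : 0 ≤ (trace (Aᴴ * (ρ * A))).re := by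
    rw [← Matrix.mul_assoc]
    exact (Complex.le_def.1 (hρ.conjTranspose_mul_mul_same A).trace_nonneg).1
  have h₂ : 0 ≤ (trace (Aᴴ * (A * σ))).re := by
    rw [trace_mul_comm]
    exact (Complex.le_def.1 (hσ.mul_mul_conjTranspose_same A).trace_nonneg).1
  have := mul_nonneg (sub_nonneg.2 hl.2.le) h₁
  have := mul_nonneg hl.1.le h₂
  simp only [leftRightForm, Matrix.mul_add, Matrix.mul_smul, trace_add, trace_smul,
    Complex.add_re, Complex.smul_re, smul_eq_mul]
  linarith

lemma leftRightForm_comm (l : ℝ) {ρ σ : Matrix n n ℂ} (hρ : ρ.IsHermitian)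
    (hσ : σ.IsHermitian) (A B : Matrix n n ℂ) :
    leftRightForm l ρ σ A B = leftRightForm l ρ σ B A := by
  have h₁ : (trace (Aᴴ * (ρ * B))).re = (trace (Bᴴ * (ρ * A))).re := by
    rw [← re_trace_conjTranspose]
    simp [conjTranspose_mul, hρ.eq, Matrix.mul_assoc]
  have h₂ : (trace (Aᴴ * (B * σ))).re = (trace (Bᴴ * (A * σ))).re := by
    rw [← re_trace_conjTranspose, conjTranspose_mul, conjTranspose_mul, hσ.eq,
      conjTranspose_conjTranspose, Matrix.mul_assoc, trace_mul_comm, Matrix.mul_assoc]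
  simp only [leftRightForm, Matrix.mul_add, Matrix.mul_smul, trace_add, trace_smul,
    Complex.add_re, Complex.smul_re, smul_eq_mul, h₁, h₂]

lemma leftRightForm_sub_smul_self (l : ℝ) {ρ σ : Matrix n n ℂ} (hρ : ρ.IsHermitian)
    (hσ : σ.IsHermitian) (A B : Matrix n n ℂ) (t : ℝ) :
    leftRightForm l ρ σ (A - t • B) (A - t • B) =
      leftRightForm l ρ σ A A - 2 * t * leftRightForm l ρ σ B A
        + t ^ 2 * leftRightForm l ρ σ B B := by
  have h := leftRightForm_comm l hρ hσ A B
  simp only [leftRightForm, conjTranspose_sub, conjTranspose_smul, star_trivial, Matrix.mul_add,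
    Matrix.mul_sub, Matrix.sub_mul, Matrix.mul_smul, Matrix.smul_mul, trace_add, trace_sub,
    trace_smul, smul_sub, Complex.add_re, Complex.sub_re, Complex.smul_re, smul_eq_mul] at h ⊢
  linear_combination (-t) * h

lemma sq_div_le_leftRightForm_self {l : ℝ} (hl : l ∈ Set.Ioo (0 : ℝ) 1)
    {ρ σ : Matrix n n ℂ} (hρ : ρ.PosSemidef) (hσ : σ.PosSemidef) (A B : Matrix n n ℂ)
    (hB : 0 < leftRightForm l ρ σ B B) :
    leftRightForm l ρ σ B A ^ 2 / leftRightForm l ρ σ B B ≤ leftRightForm l ρ σ A A := by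
  have h := leftRightForm_self_nonneg hl hρ hσ
    (A - (leftRightForm l ρ σ B A / leftRightForm l ρ σ B B) • B)
  rw [leftRightForm_sub_smul_self l hρ.isHermitian hσ.isHermitian] at h
  have key : leftRightForm l ρ σ A A
      - 2 * (leftRightForm l ρ σ B A / leftRightForm l ρ σ B B) * leftRightForm l ρ σ B A
      + (leftRightForm l ρ σ B A / leftRightForm l ρ σ B B) ^ 2 * leftRightForm l ρ σ B B
      = leftRightForm l ρ σ A A - leftRightForm l ρ σ B A ^ 2 / leftRightForm l ρ σ B B := by
    field_simp
    ring
  linarith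

lemma re_trace_mul_sub_smul_one_sq [DecidableEq n] {ρ : Matrix n n ℂ}
    (hρ : ρ.trace = 1) (Q : Matrix n n ℂ) (c : ℝ) :
    (trace (ρ * ((Q - (c : ℂ) • 1) * (Q - (c : ℂ) • 1)))).re =
      (trace (ρ * (Q * Q))).re - 2 * c * (trace (ρ * Q)).re + c ^ 2 := by
  simp only [Matrix.mul_sub, Matrix.sub_mul, Matrix.mul_smul, Matrix.smul_mul, Matrix.mul_one,
    Matrix.one_mul, trace_sub, trace_smul, smul_sub, hρ, Complex.sub_re, smul_eq_mul,
    Complex.re_ofReal_mul, Complex.one_re]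
  ring

end Matrix

/-- Quantum Chapman–Robbins bound: the `χ²_λ` divergence
`Re Tr[(ρ−σ)X_λ]`, where `X_λ` solves `(1−λ)ρX + λXσ = ρ−σ`, is bounded below by
`x²/((1−λ)v + λw + λ(1−λ)x²)` with `x = Re Tr[(ρ−σ)Q]`, `v = Var_ρ(Q)`, `w = Var_σ(Q)`. -/
theorem quantum_chapman_robbins
    (d : ℕ) (hd : 0 < d)
    (ρ σ : Matrix (Fin d) (Fin d) ℂ)
    (hρ : ρ.PosDef) (hσ : σ.PosDef)
    (hρtr : ρ.trace = 1) (hσtr : σ.trace = 1)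
    (lam : ℝ) (hlam : lam ∈ Set.Ioo (0 : ℝ) 1)
    (Q : Matrix (Fin d) (Fin d) ℂ) (hQ : Q.IsHermitian)
    (X : Matrix (Fin d) (Fin d) ℂ)
    (hX : (1 - lam) • (ρ * X) + lam • (X * σ) = ρ - σ)
    (x v w : ℝ)
    (hx : x = (Matrix.trace ((ρ - σ) * Q)).re)
    (hv : v = qVar ρ Q) (hw : w = qVar σ Q)
    (hden : 0 < (1 - lam) * v + lam * w + lam * (1 - lam) * x ^ 2) :
    (Matrix.trace ((ρ - σ) * X)).re ≥
      x ^ 2 / ((1 - lam) * v + lam * w + lam * (1 - lam) * x ^ 2) := by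
  obtain ⟨c, hc⟩ : ∃ c : ℝ, c = (1 - lam) * (trace (ρ * Q)).re + lam * (trace (σ * Q)).re :=
    ⟨_, rfl⟩
  have hK : (Q - (c : ℂ) • (1 : Matrix (Fin d) (Fin d) ℂ))ᴴ = Q - (c : ℂ) • 1 := by
    simp [hQ.eq]
  have hXX : leftRightForm lam ρ σ X X = (trace ((ρ - σ) * X)).re := by
    rw [leftRightForm, hX, ← re_trace_conjTranspose]
    simp [hρ.isHermitian.eq, hσ.isHermitian.eq]
  have hKX : leftRightForm lam ρ σ (Q - (c : ℂ) • 1) X = x := by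
    rw [leftRightForm, hX, hK, trace_mul_comm, hx]
    simp [Matrix.mul_sub, hρtr, hσtr]
  have hKK : leftRightForm lam ρ σ (Q - (c : ℂ) • 1) (Q - (c : ℂ) • 1) =
      (1 - lam) * v + lam * w + lam * (1 - lam) * x ^ 2 := by
    have h₁ : (trace ((Q - (c : ℂ) • 1) * (ρ * (Q - (c : ℂ) • 1)))).re =
        (trace (ρ * (Q * Q))).re - 2 * c * (trace (ρ * Q)).re + c ^ 2 := by
      rw [← re_trace_mul_sub_smul_one_sq hρtr, trace_mul_comm, Matrix.mul_assoc]
    have h₂ : (trace ((Q - (c : ℂ) • 1) * ((Q - (c : ℂ) • 1) * σ))).re =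
        (trace (σ * (Q * Q))).re - 2 * c * (trace (σ * Q)).re + c ^ 2 := by
      rw [← re_trace_mul_sub_smul_one_sq hσtr, ← Matrix.mul_assoc, trace_mul_comm]
    rw [leftRightForm, hK, Matrix.mul_add, Matrix.mul_smul, Matrix.mul_smul, trace_add,
      trace_smul, trace_smul, Complex.add_re, Complex.smul_re, Complex.smul_re, h₁, h₂, hv, hw,
      hx, qVar, qVar, re_trace_mul_sub_smul_one_sq hρtr, re_trace_mul_sub_smul_one_sq hσtr,
      Matrix.sub_mul, trace_sub, Complex.sub_re, hc, smul_eq_mul, smul_eq_mul]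
    ring
  have h := sq_div_le_leftRightForm_self hlam hρ.posSemidef hσ.posSemidef X
    (Q - (c : ℂ) • 1) (hKK ▸ hden)
  rwa [hXX, hKX, hKK] at h
end

section
/- Let d, m be positive integers, let ρ' and ρ be d×d positive definite Hermitian complex matrices with Tr ρ' = Tr ρ = 1, and let Q₁,…,Q_m be d×d Hermitian matrices. Define the current vector Δq ∈ ℝ^m by Δq_u := Re Tr[(ρ'−ρ)Q_u], the m×m real covariance matrices V and V' by V_{uv} := (1/2)·Re Tr[ρ{Q_u − Re Tr(ρQ_u)·I, Q_v − Re Tr(ρQ_v)·I}] and V'_{uv} := (1/2)·Re Tr[ρ'{Q_u − Re Tr(ρ'Q_u)·I, Q_v − Re Tr(ρ'Q_v)·I}], and for λ ∈ (0,1) set V_λ := (1−λ)V' + λV. Assume V_λ is positive definite for all λ ∈ (0,1), and set s_λ := Δqᵀ V_λ⁻¹ Δq. Then the matrix thermodynamic uncertainty relation holds: D(ρ'‖ρ) ≥ ∫₀¹ λ·s_λ/(1 + λ(1−λ)s_λ) dλ. -/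
open Matrix MeasureTheory
open scoped ComplexOrder

/-- Centered observable `Q − Re Tr(ρQ)·I`. -/
noncomputable def centered {n : Type*} [Fintype n] [DecidableEq n]
    (ρ Q : Matrix n n ℂ) : Matrix n n ℂ :=
  Q - (((Matrix.trace (ρ * Q)).re : ℝ) : ℂ) • 1

/-- Symmetrized covariance matrix
`V_{uv} = (1/2)·Re Tr[ρ {Q_u − ⟨Q_u⟩, Q_v − ⟨Q_v⟩}]` of the charges `Q` in state `ρ`. -/
noncomputable def covMatrix {n : Type*} [Fintype n] [DecidableEq n] {m : ℕ}
    (ρ : Matrix n n ℂ) (Q : Fin m → Matrix n n ℂ) : Matrix (Fin m) (Fin m) ℝ :=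
  Matrix.of fun u v =>
    (1 / 2) * (Matrix.trace (ρ * (centered ρ (Q u) * centered ρ (Q v) +
      centered ρ (Q v) * centered ρ (Q u)))).re

section SpectralComparison

variable {n : Type*} [Fintype n] [DecidableEq n]

/-- A spectral decomposition of a positive definite matrix that also diagonalizes `matLog`. -/
theorem exists_spectral_matLog {A : Matrix n n ℂ} (hA : A.PosDef) :
    ∃ (U : Matrix n n ℂ) (a : n → ℝ), star U * U = 1 ∧ U * star U = 1 ∧ (∀ i, 0 < a i) ∧
      A = U * diagonal (fun i => (a i : ℂ)) * star U ∧
      matLog A = U * diagonal (fun i => (Real.log (a i) : ℂ)) * star U := by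
  refine ⟨hA.isHermitian.eigenvectorUnitary, hA.isHermitian.eigenvalues,
    Unitary.coe_star_mul_self _, Unitary.coe_mul_star_self _, hA.eigenvalues_pos, ?_, ?_⟩
  · conv_lhs => rw [hA.isHermitian.spectral_theorem]
    rw [Unitary.conjStarAlgAut_apply]
    rfl
  · rw [matLog, dif_pos hA.isHermitian]

/-- The Hilbert–Schmidt product computed in a pair of orthonormal bases. -/
theorem trace_mul_conjTranspose_eq_sum {U V : Matrix n n ℂ} (hU : U * star U = 1)
    (hV : V * star V = 1) (M N : Matrix n n ℂ) :
    (M * Nᴴ).trace = ∑ i, ∑ j, (star U * M * V) i j * star ((star U * N * V) i j) := by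
  have h : (M * Nᴴ).trace = ((star U * M * V) * (star U * N * V)ᴴ).trace := by
    simp only [conjTranspose_mul, star_eq_conjTranspose, conjTranspose_conjTranspose] at hU hV ⊢
    calc (M * Nᴴ).trace = ((U * Uᴴ) * M * (V * Vᴴ) * Nᴴ).trace := by
          rw [hU, hV, one_mul, mul_one]
      _ = (U * (Uᴴ * M * V * (Vᴴ * Nᴴ))).trace := by simp only [mul_assoc]
      _ = _ := by rw [trace_mul_comm]; simp only [mul_assoc]
  rw [h]
  simp only [trace, diag_apply, mul_apply (M := star U * M * V), conjTranspose_apply]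

theorem star_mul_conj_diagonal_mul_apply {U : Matrix n n ℂ} (hU : star U * U = 1)
    (c : n → ℂ) (Y : Matrix n n ℂ) (i j : n) :
    (star U * (U * diagonal c * star U) * Y) i j = c i * (star U * Y) i j := by
  have : star U * (U * diagonal c * star U) * Y = (star U * U) * (diagonal c * (star U * Y)) := by
    simp only [mul_assoc]
  rw [this, hU, one_mul, diagonal_mul]

theorem mul_conj_diagonal_mul_apply {V : Matrix n n ℂ} (hV : star V * V = 1)
    (c : n → ℂ) (Y : Matrix n n ℂ) (i j : n) :
    (Y * (V * diagonal c * star V) * V) i j = (Y * V) i j * c j := by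
  have : Y * (V * diagonal c * star V) * V = (Y * V) * diagonal c * (star V * V) := by
    simp only [mul_assoc]
  rw [this, hV, mul_one, mul_diagonal]

theorem isHermitian_conj_diagonal_ofReal (U : Matrix n n ℂ) (a : n → ℝ) :
    (U * diagonal (fun i => (a i : ℂ)) * star U).IsHermitian := by
  rw [star_eq_conjTranspose]
  exact isHermitian_mul_mul_conjTranspose U (isHermitian_diagonal_iff.2 fun i => by
    simp [isSelfAdjoint_iff])

theorem isHermitian_matLog (A : Matrix n n ℂ) : (matLog A).IsHermitian := by
  unfold matLog
  split_ifs with hA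
  · exact isHermitian_conj_diagonal_ofReal _ _
  · exact isHermitian_zero

/-- The logarithmic mean is at most the arithmetic mean. -/
theorem two_mul_sq_sub_div_add_le {a b : ℝ} (ha : 0 < a) (hb : 0 < b) :
    2 * (b - a) ^ 2 / (a + b) ≤ (b - a) * (Real.log b - Real.log a) := by
  have key : ∀ {x y : ℝ}, 0 < x → x ≤ y →
      2 * (y - x) ^ 2 / (x + y) ≤ (y - x) * (Real.log y - Real.log x) := by
    intro x y hx hxy
    have hy : 0 < y := hx.trans_le hxy
    have h := Real.le_log_one_add_of_nonneg (x := (y - x) / x)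
      (div_nonneg (sub_nonneg.2 hxy) hx.le)
    have e1 : 1 + (y - x) / x = y / x := by field_simp; ring
    have e2 : 2 * ((y - x) / x) / ((y - x) / x + 2) = 2 * (y - x) / (x + y) := by
      have : (y - x) / x + 2 = (x + y) / x := by field_simp; ring
      rw [this]
      field_simp
    rw [e1, e2, Real.log_div hy.ne' hx.ne'] at h
    calc 2 * (y - x) ^ 2 / (x + y) = (y - x) * (2 * (y - x) / (x + y)) := by ring
      _ ≤ _ := mul_le_mul_of_nonneg_left h (sub_nonneg.2 hxy)
  rcases le_total a b with h | h
  · exact key ha h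
  · have := key hb h
    rw [add_comm b a] at this
    calc _ = 2 * (a - b) ^ 2 / (a + b) := by ring
      _ ≤ _ := this
      _ = _ := by ring

theorem two_mul_re_sub_le_log {a b : ℝ} (ha : 0 < a) (hb : 0 < b) (w z : ℂ) :
    2 * (w * (b - a) * star z).re - (1 / 2) * (a + b) * Complex.normSq z ≤
      (b - a) * (Real.log b - Real.log a) * Complex.normSq w := by
  have h := mul_le_mul_of_nonneg_right (two_mul_sq_sub_div_add_le ha hb) (Complex.normSq_nonneg w)
  refine le_trans ?_ h
  have hab : 0 < a + b := add_pos ha hb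
  rw [← sub_nonneg]
  have : 2 * (b - a) ^ 2 / (a + b) * Complex.normSq w -
      (2 * (w * (b - a) * star z).re - (1 / 2) * (a + b) * Complex.normSq z) =
      ((2 * (b - a) * w.re - (a + b) * z.re) ^ 2 + (2 * (b - a) * w.im - (a + b) * z.im) ^ 2) /
        (2 * (a + b)) := by
    simp [Complex.normSq_apply]
    field_simp
    ring
  rw [this]
  positivity

/-- Quadratic lower bound on the log-increment: the Kubo–Mori form dominates the dual of the
symmetrized second moment in the midpoint state. -/
theorem two_mul_re_trace_sub_le_matLog {A B Y : Matrix n n ℂ} (hA : A.PosDef) (hB : B.PosDef)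
    (hY : Y.IsHermitian) :
    2 * ((B - A) * Y).trace.re - (1 / 2) * ((A + B) * (Y * Y)).trace.re ≤
      ((B - A) * (matLog B - matLog A)).trace.re := by
  have hL := ((isHermitian_matLog B).sub (isHermitian_matLog A)).eq
  obtain ⟨U, a, hU, hU', ha, rfl, hlA⟩ := exists_spectral_matLog hA
  obtain ⟨V, b, hV, hV', hb, rfl, hlB⟩ := exists_spectral_matLog hB
  rw [hlA, hlB] at hL ⊢
  have e1 := trace_mul_conjTranspose_eq_sum hU' hV' (V * diagonal (fun i => (b i : ℂ)) * star V -
    U * diagonal (fun i => (a i : ℂ)) * star U) Y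
  have e2 := trace_mul_conjTranspose_eq_sum hU' hV'
    (U * diagonal (fun i => (a i : ℂ)) * star U * Y) Y
  have e3 := trace_mul_conjTranspose_eq_sum hU' hV'
    (Y * (V * diagonal (fun i => (b i : ℂ)) * star V)) Y
  have e4 := trace_mul_conjTranspose_eq_sum hU' hV' (V * diagonal (fun i => (b i : ℂ)) * star V -
    U * diagonal (fun i => (a i : ℂ)) * star U)
    (V * diagonal (fun i => (Real.log (b i) : ℂ)) * star V -
    U * diagonal (fun i => (Real.log (a i) : ℂ)) * star U)
  rw [hL] at e4
  rw [hY.eq] at e1 e2 e3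
  rw [trace_mul_comm, ← mul_assoc, trace_mul_comm] at e3
  have e2' : ∀ i j, (star U * (U * diagonal (fun i => (a i : ℂ)) * star U * Y) * V) i j =
      a i * (star U * Y * V) i j := fun i j => by
    rw [← mul_assoc (star U), mul_assoc _ Y V, star_mul_conj_diagonal_mul_apply hU, mul_assoc]
  have e3' : ∀ i j, (star U * (Y * (V * diagonal (fun i => (b i : ℂ)) * star V)) * V) i j =
      (star U * Y * V) i j * b j := fun i j => by
    rw [← mul_assoc (star U), mul_conj_diagonal_mul_apply hV]
  simp only [mul_sub (star U), sub_mul _ _ V, Matrix.sub_apply, star_mul_conj_diagonal_mul_apply hU,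
    mul_conj_diagonal_mul_apply hV, e2', e3'] at e1 e2 e3 e4
  rw [mul_assoc] at e2
  rw [e4, e1, add_mul, trace_add, e2, e3]
  simp only [Complex.add_re, Complex.re_sum, Finset.mul_sum, ← Finset.sum_add_distrib,
    ← Finset.sum_sub_distrib]
  refine Finset.sum_le_sum fun i _ => Finset.sum_le_sum fun j _ => ?_
  have h := two_mul_re_sub_le_log (ha i) (hb j) ((star U * V) i j) ((star U * Y * V) i j)
  generalize (star U * V) i j = w at h ⊢
  generalize (star U * Y * V) i j = z at h ⊢
  simp [Complex.normSq_apply] at h ⊢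
  linarith

/-- Klein's inequality. -/
theorem re_trace_sub_le_qRelEnt {A B : Matrix n n ℂ} (hA : A.PosDef) (hB : B.PosDef) :
    (A - B).trace.re ≤ qRelEnt A B := by
  unfold qRelEnt
  have hL := ((isHermitian_matLog A).sub (isHermitian_matLog B)).eq
  obtain ⟨U, a, hU, hU', ha, rfl, hlA⟩ := exists_spectral_matLog hA
  obtain ⟨V, b, hV, hV', hb, rfl, hlB⟩ := exists_spectral_matLog hB
  rw [hlA, hlB] at hL ⊢
  have e1 := trace_mul_conjTranspose_eq_sum hU' hV' (U * diagonal (fun i => (a i : ℂ)) * star U -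
    V * diagonal (fun i => (b i : ℂ)) * star V) 1
  have e2 := trace_mul_conjTranspose_eq_sum hU' hV' (U * diagonal (fun i => (a i : ℂ)) * star U)
    (U * diagonal (fun i => (Real.log (a i) : ℂ)) * star U -
    V * diagonal (fun i => (Real.log (b i) : ℂ)) * star V)
  rw [hL] at e2
  rw [conjTranspose_one, mul_one] at e1
  simp only [mul_sub (star U), sub_mul _ _ V, Matrix.sub_apply, star_mul_conj_diagonal_mul_apply hU,
    mul_conj_diagonal_mul_apply hV, mul_one] at e1 e2
  rw [e1, e2]
  simp only [Complex.re_sum]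
  refine Finset.sum_le_sum fun i _ => Finset.sum_le_sum fun j _ => ?_
  have hlog : a i - b j ≤ a i * (Real.log (a i) - Real.log (b j)) := by
    have h := Real.one_sub_inv_le_log_of_pos (div_pos (ha i) (hb j))
    rw [Real.log_div (ha i).ne' (hb j).ne', inv_div] at h
    have h' := mul_le_mul_of_nonneg_left h (ha i).le
    have : a i * (1 - b j / a i) = a i - b j := by
      have := (ha i).ne'
      field_simp
    linarith
  have h := mul_le_mul_of_nonneg_right hlog (Complex.normSq_nonneg ((star U * V) i j))
  generalize (star U * V) i j = w at h ⊢
  simp [Complex.normSq_apply] at h ⊢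
  linarith

/-- The mixture `(1 - t) ρ' + t ρ`. -/
noncomputable def mixture (ρ' ρ : Matrix n n ℂ) (t : ℝ) : Matrix n n ℂ :=
  (1 - t) • ρ' + t • ρ

theorem posDef_mixture {ι : Type*} {ρ' ρ : Matrix ι ι ℂ} (hρ' : ρ'.PosDef) (hρ : ρ.PosDef) {t : ℝ}
    (h0 : 0 ≤ t) (h1 : t ≤ 1) : (mixture ρ' ρ t).PosDef := by
  unfold mixture
  rcases h0.eq_or_lt with rfl | h0
  · simpa using hρ'
  · exact PosDef.posSemidef_add (hρ'.posSemidef.smul (sub_nonneg.2 h1)) (hρ.smul h0)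

theorem re_trace_mixture_mul (ρ' ρ M : Matrix n n ℂ) (t : ℝ) :
    (mixture ρ' ρ t * M).trace.re = (1 - t) * (ρ' * M).trace.re + t * (ρ * M).trace.re := by
  simp [mixture, add_mul, trace_add, trace_smul]

/-- The relative entropy increases along the mixture at least at the rate given by the quadratic
functional of any Hermitian test matrix. -/
theorem le_re_trace_mul_matLog_mixture_sub {ρ' ρ : Matrix n n ℂ} (hρ' : ρ'.PosDef)
    (hρ : ρ.PosDef) (htr : ρ'.trace = ρ.trace) {X : Matrix n n ℂ} (hX : X.IsHermitian) {s t : ℝ}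
    (hs : 0 ≤ s) (hst : s < t) (ht : t ≤ 1) :
    s * (t - s) * (2 * ((ρ' - ρ) * X).trace.re -
      (1 / 2) * ((mixture ρ' ρ s * (X * X)).trace.re + (mixture ρ' ρ t * (X * X)).trace.re)) ≤
      (ρ' * (matLog (mixture ρ' ρ s) - matLog (mixture ρ' ρ t))).trace.re := by
  have hps := posDef_mixture hρ' hρ hs (hst.le.trans ht)
  have hpt := posDef_mixture hρ' hρ (hs.trans hst.le) ht
  have klein := re_trace_sub_le_qRelEnt hps hpt
  have quad := two_mul_re_trace_sub_le_matLog hps hpt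
    (hX.smul (k := -(t - s)) (by simp [IsSelfAdjoint]))
  have hdiff : mixture ρ' ρ t - mixture ρ' ρ s = (-(t - s)) • (ρ' - ρ) := by
    unfold mixture; module
  have hdecomp : ρ' = mixture ρ' ρ s + s • (ρ' - ρ) := by
    unfold mixture; module
  have hzero : (mixture ρ' ρ s - mixture ρ' ρ t).trace.re = 0 := by
    rw [← neg_sub, hdiff]
    simp [trace_sub, htr]
  rw [hzero, qRelEnt] at klein
  rw [hdiff] at quad
  rw [← neg_sub (matLog (mixture ρ' ρ s))] at quad
  set L := matLog (mixture ρ' ρ s) - matLog (mixture ρ' ρ t)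
  have hL : (ρ' * L).trace.re = (mixture ρ' ρ s * L).trace.re + s * ((ρ' - ρ) * L).trace.re := by
    conv_lhs => rw [hdecomp]
    simp only [add_mul, smul_mul_assoc, trace_add, trace_smul, Complex.add_re, Complex.smul_re,
      smul_eq_mul]
  rw [hL]
  simp only [add_mul, smul_mul_assoc, mul_smul_comm, trace_add, trace_smul, Complex.add_re,
    Complex.smul_re, smul_eq_mul, mul_neg, trace_neg, Complex.neg_re] at quad
  have hts : 0 < t - s := sub_pos.2 hst
  have hdiv : (t - s) * (2 * ((ρ' - ρ) * X).trace.re -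
      (1 / 2) * ((mixture ρ' ρ s * (X * X)).trace.re + (mixture ρ' ρ t * (X * X)).trace.re)) ≤
      ((ρ' - ρ) * L).trace.re := by
    refine le_of_mul_le_mul_left ?_ hts
    linarith
  have := mul_le_mul_of_nonneg_left hdiv hs
  linarith

theorem monotoneOn_neg_re_trace_mul_matLog_mixture {ρ' ρ : Matrix n n ℂ} (hρ' : ρ'.PosDef)
    (hρ : ρ.PosDef) (htr : ρ'.trace = ρ.trace) :
    MonotoneOn (fun t => -(ρ' * matLog (mixture ρ' ρ t)).trace.re) (Set.Icc 0 1) := by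
  intro s hs t ht hst
  rcases hst.eq_or_lt with rfl | hst
  · exact le_rfl
  · have := le_re_trace_mul_matLog_mixture_sub hρ' hρ htr isHermitian_zero hs.1 hst ht.2
    simp [mul_sub, trace_sub] at this ⊢
    linarith

/-- Lower bound for the derivative of the relative entropy along the mixture. -/
theorem le_deriv_neg_re_trace_mul_matLog_mixture {ρ' ρ : Matrix n n ℂ} (hρ' : ρ'.PosDef)
    (hρ : ρ.PosDef) (htr : ρ'.trace = ρ.trace) {X : Matrix n n ℂ} (hX : X.IsHermitian) {s : ℝ}
    (hs : s ∈ Set.Ioo (0 : ℝ) 1)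
    (hd : DifferentiableAt ℝ (fun t => -(ρ' * matLog (mixture ρ' ρ t)).trace.re) s) :
    s * (2 * ((ρ' - ρ) * X).trace.re - (mixture ρ' ρ s * (X * X)).trace.re) ≤
      deriv (fun t => -(ρ' * matLog (mixture ρ' ρ t)).trace.re) s := by
  have hslope := (hasDerivAt_iff_tendsto_slope.1 hd.hasDerivAt).mono_left
    (nhdsWithin_mono s fun t (ht : s < t) => ht.ne')
  have hlim : Filter.Tendsto (fun t => s * (2 * ((ρ' - ρ) * X).trace.re -
      (1 / 2) * ((mixture ρ' ρ s * (X * X)).trace.re + (mixture ρ' ρ t * (X * X)).trace.re)))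
      (nhdsWithin s (Set.Ioi s))
      (nhds (s * (2 * ((ρ' - ρ) * X).trace.re - (mixture ρ' ρ s * (X * X)).trace.re))) := by
    have hc : Continuous fun t => s * (2 * ((ρ' - ρ) * X).trace.re -
      (1 / 2) * ((mixture ρ' ρ s * (X * X)).trace.re + (mixture ρ' ρ t * (X * X)).trace.re)) := by
      simp only [re_trace_mixture_mul]
      fun_prop
    have h := (hc.tendsto s).mono_left (nhdsWithin_le_nhds (s := Set.Ioi s))
    convert h using 2
    ring
  refine le_of_tendsto_of_tendsto hlim hslope ?_
  filter_upwards [Ioo_mem_nhdsGT hs.2] with t ht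
  have h := le_re_trace_mul_matLog_mixture_sub hρ' hρ htr hX hs.1.le ht.1 ht.2.le
  rw [slope_def_field, le_div_iff₀ (sub_pos.2 ht.1)]
  rw [mul_sub ρ', trace_sub, Complex.sub_re] at h
  linarith

theorem isHermitian_centered (ρ : Matrix n n ℂ) {Q : Matrix n n ℂ} (hQ : Q.IsHermitian) :
    (centered ρ Q).IsHermitian :=
  hQ.sub (isHermitian_one.smul (by simp [IsSelfAdjoint]))

theorem re_trace_mul_centered_sq {ρ : Matrix n n ℂ} (htr : ρ.trace = 1) (Q : Matrix n n ℂ) :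
    (ρ * (centered ρ Q * centered ρ Q)).trace.re =
      (ρ * (Q * Q)).trace.re - (ρ * Q).trace.re ^ 2 := by
  simp [centered, mul_sub, sub_mul, trace_sub, trace_smul, htr]
  ring

theorem centered_sum_smul {m : ℕ} (ρ : Matrix n n ℂ) (Q : Fin m → Matrix n n ℂ)
    (x : Fin m → ℝ) : centered ρ (∑ u, x u • Q u) = ∑ u, x u • centered ρ (Q u) := by
  simp only [centered, smul_sub, Finset.sum_sub_distrib, Finset.mul_sum, trace_sum,
    mul_smul_comm, trace_smul, Complex.re_sum, Complex.smul_re, Complex.ofReal_sum,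
    Finset.sum_smul]
  congr 1
  refine Finset.sum_congr rfl fun u _ => ?_
  ext i j
  simp [mul_assoc]

theorem dotProduct_covMatrix_mulVec {m : ℕ} (ρ : Matrix n n ℂ) (Q : Fin m → Matrix n n ℂ)
    (x : Fin m → ℝ) :
    x ⬝ᵥ (covMatrix ρ Q).mulVec x =
      (ρ * (centered ρ (∑ u, x u • Q u) * centered ρ (∑ u, x u • Q u))).trace.re := by
  set F : Fin m → Fin m → ℝ := fun u v =>
    x u * x v * (ρ * (centered ρ (Q u) * centered ρ (Q v))).trace.re
  have h1 : x ⬝ᵥ (covMatrix ρ Q).mulVec x = ∑ u, ∑ v, (1 / 2) * (F u v + F v u) := by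
    simp only [dotProduct, mulVec, covMatrix, of_apply, Finset.mul_sum, F, mul_add, trace_add,
      Complex.add_re]
    refine Finset.sum_congr rfl fun u _ => Finset.sum_congr rfl fun v _ => ?_
    ring
  have h2 : ∑ u, ∑ v, F v u = ∑ u, ∑ v, F u v := Finset.sum_comm
  have h3 : (ρ * (centered ρ (∑ u, x u • Q u) * centered ρ (∑ u, x u • Q u))).trace.re =
      ∑ u, ∑ v, F u v := by
    rw [centered_sum_smul, Finset.sum_mul_sum]
    simp only [Finset.mul_sum, trace_sum, Complex.re_sum, F,
      smul_mul_assoc, mul_smul_comm, trace_smul, Complex.smul_re, smul_eq_mul, mul_assoc]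
    refine Finset.sum_congr rfl fun u _ => Finset.sum_congr rfl fun v _ => ?_
    ring
  rw [h1, h3]
  simp only [← Finset.mul_sum, Finset.sum_add_distrib, h2]
  ring

/-- Variance in a mixture: mean of the variances plus the variance of the means. -/
theorem re_trace_mixture_mul_centered_sq {m : ℕ} {ρ' ρ : Matrix n n ℂ} (hρ' : ρ'.trace = 1)
    (hρ : ρ.trace = 1) (Q : Fin m → Matrix n n ℂ) (x : Fin m → ℝ) (t : ℝ) :
    (mixture ρ' ρ t * (centered (mixture ρ' ρ t) (∑ u, x u • Q u) *
      centered (mixture ρ' ρ t) (∑ u, x u • Q u))).trace.re =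
      x ⬝ᵥ ((1 - t) • covMatrix ρ' Q + t • covMatrix ρ Q).mulVec x +
        t * (1 - t) * ((ρ' - ρ) * ∑ u, x u • Q u).trace.re ^ 2 := by
  have htr : (mixture ρ' ρ t).trace = 1 := by
    simp [mixture, trace_add, trace_smul, hρ', hρ]
  rw [re_trace_mul_centered_sq htr, add_mulVec, dotProduct_add, smul_mulVec, smul_mulVec,
    dotProduct_smul, dotProduct_smul, dotProduct_covMatrix_mulVec, dotProduct_covMatrix_mulVec,
    re_trace_mul_centered_sq hρ', re_trace_mul_centered_sq hρ, re_trace_mixture_mul,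
    re_trace_mixture_mul, sub_mul ρ', trace_sub, Complex.sub_re, smul_eq_mul, smul_eq_mul]
  ring

end SpectralComparison

/-- Matrix thermodynamic uncertainty relation:
`D(ρ'‖ρ) ≥ ∫₀¹ λ s_λ / (1 + λ(1−λ) s_λ) dλ`, with
`s_λ = Δqᵀ V_λ⁻¹ Δq` and `V_λ = (1−λ)V' + λV`. -/
theorem matrix_TUR
    (d m : ℕ) (hd : 0 < d) (hm : 0 < m)
    (ρ' ρ : Matrix (Fin d) (Fin d) ℂ)
    (hρ' : ρ'.PosDef) (hρ : ρ.PosDef)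
    (hρ'tr : ρ'.trace = 1) (hρtr : ρ.trace = 1)
    (Q : Fin m → Matrix (Fin d) (Fin d) ℂ) (hQ : ∀ u, (Q u).IsHermitian)
    (Δq : Fin m → ℝ)
    (hΔq : ∀ u, Δq u = (Matrix.trace ((ρ' - ρ) * Q u)).re)
    (V V' : Matrix (Fin m) (Fin m) ℝ)
    (hV : V = covMatrix ρ Q) (hV' : V' = covMatrix ρ' Q)
    (Vlam : ℝ → Matrix (Fin m) (Fin m) ℝ)
    (hVlam : ∀ lam : ℝ, Vlam lam = (1 - lam) • V' + lam • V)
    (hVlamPD : ∀ lam ∈ Set.Ioo (0 : ℝ) 1, (Vlam lam).PosDef)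
    (slam : ℝ → ℝ)
    (hslam : ∀ lam : ℝ, slam lam = Δq ⬝ᵥ ((Vlam lam)⁻¹).mulVec Δq) :
    qRelEnt ρ' ρ ≥
      ∫ lam in (0:ℝ)..1, lam * slam lam / (1 + lam * (1 - lam) * slam lam) := by
  subst hV hV'
  have htr : ρ'.trace = ρ.trace := hρ'tr.trans hρtr.symm
  set f : ℝ → ℝ := fun t => -(ρ' * matLog (mixture ρ' ρ t)).trace.re with hf
  have hmono : MonotoneOn f (Set.Icc 0 1) :=
    monotoneOn_neg_re_trace_mul_matLog_mixture hρ' hρ htr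
  have hD : qRelEnt ρ' ρ = f 1 - f 0 := by
    simp [qRelEnt, hf, mixture, mul_sub, trace_sub]
    ring
  have hf01 : f 0 ≤ f 1 := hmono (by simp) (by simp) zero_le_one
  rw [hD, ge_iff_le]
  by_cases hint : IntervalIntegrable
      (fun lam => lam * slam lam / (1 + lam * (1 - lam) * slam lam)) volume 0 1
  swap
  · rw [intervalIntegral.integral_undef hint]
    linarith
  have hmono' : MonotoneOn f (Set.uIcc 0 1) := by rwa [Set.uIcc_of_le zero_le_one]
  have hderiv : ∫ t in (0 : ℝ)..1, deriv f t ≤ f 1 - f 0 := by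
    have h := hmono'.intervalIntegral_deriv_mem_uIcc
    rw [Set.uIcc_of_le (sub_nonneg.2 hf01)] at h
    exact h.2
  refine le_trans ?_ hderiv
  refine intervalIntegral.integral_mono_ae_restrict zero_le_one hint
    hmono'.intervalIntegrable_deriv ?_
  rw [← restrict_Ioo_eq_restrict_Icc, Filter.EventuallyLE, ae_restrict_iff' measurableSet_Ioo]
  filter_upwards [hmono.ae_differentiableWithinAt_of_mem] with t hdiff ht
  have hd : DifferentiableAt ℝ f t :=
    (hdiff (Set.Ioo_subset_Icc_self ht)).differentiableAt (Icc_mem_nhds ht.1 ht.2)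
  have hPD := hVlamPD t ht
  set x : Fin m → ℝ := ((Vlam t)⁻¹).mulVec Δq with hx
  have hVx : (Vlam t).mulVec x = Δq := by
    rw [hx, mulVec_mulVec, mul_nonsing_inv _ ((isUnit_iff_isUnit_det _).1 hPD.isUnit), one_mulVec]
  have hs : slam t = Δq ⬝ᵥ x := hslam t
  have hs0 : 0 ≤ slam t := by
    have h := hPD.posSemidef.dotProduct_mulVec_nonneg x
    rw [hVx, star_trivial, dotProduct_comm] at h
    rwa [hs]
  have hmean : ((ρ' - ρ) * ∑ u, x u • Q u).trace.re = slam t := by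
    rw [hs]
    simp only [Finset.mul_sum, trace_sum, mul_smul_comm, trace_smul, Complex.re_sum,
      Complex.smul_re, smul_eq_mul, dotProduct, hΔq]
    exact Finset.sum_congr rfl fun u _ => mul_comm _ _
  have hvar := re_trace_mixture_mul_centered_sq hρ'tr hρtr Q x t
  rw [← hVlam, hVx, hmean, dotProduct_comm, ← hs] at hvar
  set C := centered (mixture ρ' ρ t) (∑ u, x u • Q u) with hC
  have hCmean : ((ρ' - ρ) * C).trace.re = slam t := by
    rw [hC, centered, mul_sub, trace_sub, Complex.sub_re, hmean]
    simp [trace_smul, trace_sub, htr]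
  have hherm : (∑ u, x u • Q u).IsHermitian := by
    simp only [IsHermitian, conjTranspose_sum, conjTranspose_smul, star_trivial, (hQ _).eq]
  have hpos : 0 < 1 + t * (1 - t) * slam t := by
    have := mul_nonneg (mul_nonneg ht.1.le (sub_nonneg.2 ht.2.le)) hs0
    linarith
  set c : ℝ := (1 + t * (1 - t) * slam t)⁻¹ with hc
  have key := le_deriv_neg_re_trace_mul_matLog_mixture hρ' hρ htr
    (X := c • C) ((isHermitian_centered _ hherm).smul (by simp [IsSelfAdjoint])) ht hd
  simp only [smul_mul_assoc, mul_smul_comm, trace_smul, Complex.smul_re, smul_eq_mul, hvar,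
    hCmean] at key
  refine le_trans (le_of_eq ?_) key
  rw [hc]
  field_simp
  ring
end

section
/- For every real s > 0, the integral ∫₀¹ λ·s/(1+λ(1−λ)s) dλ equals 2·√(s/(s+4))·artanh(√(s/(s+4))). -/
open MeasureTheory

/-- Inverse hyperbolic tangent: `artanh x = (1/2)·log((1+x)/(1−x))`. -/
noncomputable def artanh (x : ℝ) : ℝ :=
  (1 / 2) * Real.log ((1 + x) / (1 - x))

theorem hasDerivAt_integral_closed_form_primitive {r x : ℝ}
    (hp : 1 + r * (2 * x - 1) ≠ 0) (hm : 1 - r * (2 * x - 1) ≠ 0) :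
    HasDerivAt
      (fun y : ℝ => (r - 1) / 2 * Real.log (1 + r * (2 * y - 1))
        - (r + 1) / 2 * Real.log (1 - r * (2 * y - 1)))
      (4 * r ^ 2 * x / (1 - r ^ 2 * (2 * x - 1) ^ 2)) x := by
  have hu : HasDerivAt (fun y : ℝ => r * (2 * y - 1)) (r * (2 * 1)) x :=
    (((hasDerivAt_id x).const_mul 2).sub_const 1).const_mul r
  have hfactor : 1 - r ^ 2 * (2 * x - 1) ^ 2 =
      (1 + r * (2 * x - 1)) * (1 - r * (2 * x - 1)) := by ring
  refine ((((hu.const_add 1).log hp).const_mul ((r - 1) / 2)).sub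
    (((hu.const_sub 1).log hm).const_mul ((r + 1) / 2))).congr_deriv ?_
  rw [hfactor]
  field_simp
  ring

theorem integral_eq_two_mul_artanh {r : ℝ} (h0 : 0 ≤ r) (h1 : r < 1) :
    ∫ x in (0 : ℝ)..1, 4 * r ^ 2 * x / (1 - r ^ 2 * (2 * x - 1) ^ 2) = 2 * r * artanh r := by
  have hpm : ∀ x ∈ Set.uIcc (0 : ℝ) 1,
      0 < 1 + r * (2 * x - 1) ∧ 0 < 1 - r * (2 * x - 1) := by
    intro x hx
    rw [Set.uIcc_of_le zero_le_one] at hx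
    constructor <;> nlinarith [hx.1, hx.2, mul_nonneg h0 hx.1, mul_nonneg h0 (sub_nonneg.2 hx.2)]
  have hne : ∀ x ∈ Set.uIcc (0 : ℝ) 1, 1 - r ^ 2 * (2 * x - 1) ^ 2 ≠ 0 := by
    intro x hx
    nlinarith [mul_pos (hpm x hx).1 (hpm x hx).2]
  rw [intervalIntegral.integral_eq_sub_of_hasDerivAt
    (fun x hx => hasDerivAt_integral_closed_form_primitive (hpm x hx).1.ne' (hpm x hx).2.ne')
    (ContinuousOn.intervalIntegrable (ContinuousOn.div (by fun_prop) (by fun_prop) hne)),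
    artanh, Real.log_div (by linarith) (by linarith)]
  norm_num
  ring_nf

/-- Closed form of the TUR integral:
`∫₀¹ λ s / (1 + λ(1−λ)s) dλ = 2·√(s/(s+4))·artanh(√(s/(s+4)))` for `s > 0`. -/
theorem integral_closed_form (s : ℝ) (hs : 0 < s) :
    (∫ lam in (0:ℝ)..1, lam * s / (1 + lam * (1 - lam) * s)) =
      2 * Real.sqrt (s / (s + 4)) * artanh (Real.sqrt (s / (s + 4))) := by
  have hlt : Real.sqrt (s / (s + 4)) < 1 := by
    rw [Real.sqrt_lt' one_pos, one_pow, div_lt_one (by linarith)]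
    linarith
  rw [← integral_eq_two_mul_artanh (Real.sqrt_nonneg _) hlt, Real.sq_sqrt (by positivity)]
  refine intervalIntegral.integral_congr fun x hx => ?_
  rw [Set.uIcc_of_le zero_le_one] at hx
  have hx1 : 0 ≤ 1 - x := sub_nonneg.2 hx.2
  have hd : 0 < 1 + x * (1 - x) * s := by
    have := hx.1
    positivity
  have hd' : 1 - s / (s + 4) * (2 * x - 1) ^ 2 = 4 * (1 + x * (1 - x) * s) / (s + 4) := by
    field_simp
    ring
  simp only [hd']
  field_simp
end

section
/- Define F : [0,∞) → ℝ by F(s) := ∫₀¹ λ·s/(1+λ(1−λ)s) dλ. Then for every real y ≥ 0, F(4·sinh²(y)) = 2·y·tanh(y). -/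
open MeasureTheory

/-- `F(s) := ∫₀¹ λ s / (1 + λ(1−λ) s) dλ`. -/
noncomputable def Fbound (s : ℝ) : ℝ :=
  ∫ lam in (0:ℝ)..1, lam * s / (1 + lam * (1 - lam) * s)

/-- Antiderivative of the integrand, from the factorization
`1 + 4 x (1 - x) S² = (C + S (2 x - 1)) (C - S (2 x - 1))` when `C² = 1 + S²`. -/
theorem hasDerivAt_Fbound_primitive {C S x : ℝ} (hCS : C ^ 2 = S ^ 2 + 1) (hC : C ≠ 0)
    (hp : C + S * (2 * x - 1) ≠ 0) (hm : C - S * (2 * x - 1) ≠ 0) :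
    HasDerivAt (fun t : ℝ =>
      (S / C - 1) / 2 * Real.log (C + S * (2 * t - 1))
        - (S / C + 1) / 2 * Real.log (C - S * (2 * t - 1)))
      (x * (4 * S ^ 2) / (1 + x * (1 - x) * (4 * S ^ 2))) x := by
  have hlin : HasDerivAt (fun t : ℝ => S * (2 * t - 1)) (S * (2 * 1)) x :=
    (((hasDerivAt_id x).const_mul 2).sub_const 1).const_mul S
  have hden : 1 + x * (1 - x) * (4 * S ^ 2)
      = (C + S * (2 * x - 1)) * (C - S * (2 * x - 1)) := by
    linear_combination -hCS
  refine ((((hlin.const_add C).log hp).const_mul ((S / C - 1) / 2)).sub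
    (((hlin.const_sub C).log hm).const_mul ((S / C + 1) / 2))).congr_deriv ?_
  rw [hden]
  field_simp
  ring

/-- Hyperbolic parametrization of the TUR bound:
`F(4 sinh² y) = 2 y tanh y` for every `y ≥ 0`. -/
theorem Fbound_sinh_param (y : ℝ) (hy : 0 ≤ y) :
    Fbound (4 * Real.sinh y ^ 2) = 2 * y * Real.tanh y := by
  have hS : 0 ≤ Real.sinh y := Real.sinh_nonneg_iff.2 hy
  have hC := Real.cosh_pos y
  have hlt := Real.sinh_lt_cosh y
  have hplus : ∀ x ∈ Set.uIcc (0 : ℝ) 1, Real.cosh y + Real.sinh y * (2 * x - 1) ≠ 0 := by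
    intro x hx
    rw [Set.uIcc_of_le zero_le_one] at hx
    exact ne_of_gt (by nlinarith [mul_nonneg hS hx.1])
  have hminus : ∀ x ∈ Set.uIcc (0 : ℝ) 1, Real.cosh y - Real.sinh y * (2 * x - 1) ≠ 0 := by
    intro x hx
    rw [Set.uIcc_of_le zero_le_one] at hx
    exact ne_of_gt (by nlinarith [mul_nonneg hS (sub_nonneg.2 hx.2)])
  have hint : IntervalIntegrable (fun x : ℝ => x * (4 * Real.sinh y ^ 2)
      / (1 + x * (1 - x) * (4 * Real.sinh y ^ 2))) volume 0 1 := by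
    refine ContinuousOn.intervalIntegrable (ContinuousOn.div (by fun_prop) (by fun_prop) ?_)
    intro x hx
    rw [Set.uIcc_of_le zero_le_one] at hx
    have := mul_nonneg hx.1 (sub_nonneg.2 hx.2)
    positivity
  have hexp : Real.cosh y + Real.sinh y = Real.exp y := Real.cosh_add_sinh y
  have hexp_neg : Real.cosh y - Real.sinh y = Real.exp (-y) := Real.cosh_sub_sinh y
  rw [Fbound, intervalIntegral.integral_eq_sub_of_hasDerivAt (fun x hx =>
    hasDerivAt_Fbound_primitive (Real.cosh_sq y) hC.ne' (hplus x hx) (hminus x hx)) hint,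
    Real.tanh_eq_sinh_div_cosh]
  norm_num [← sub_eq_add_neg, hexp, hexp_neg]
  ring
end

section
/- Let n be a positive integer and let p, q : Fin n → ℝ be strictly positive probability vectors (p_i > 0, q_i > 0, Σᵢ p_i = Σᵢ q_i = 1). Then the Kullback–Leibler divergence admits the integral representation Σᵢ p_i·log(p_i/q_i) = ∫₀¹ λ·χ²_λ(p‖q) dλ, where χ²_λ(p‖q) := Σᵢ (p_i − q_i)²/((1−λ)p_i + λq_i). -/
open MeasureTheory

lemma convexComb_pos {a b t : ℝ} (ha : 0 < a) (hb : 0 < b) (ht : t ∈ Set.Icc (0 : ℝ) 1) :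
    0 < (1 - t) * a + t * b :=
  convex_Ioi (0 : ℝ) ha hb (sub_nonneg.2 ht.2) ht.1 (by ring)

lemma intervalIntegrable_mul_sq_sub_div_convexComb {a b : ℝ} (ha : 0 < a) (hb : 0 < b) :
    IntervalIntegrable (fun t : ℝ => t * ((a - b) ^ 2 / ((1 - t) * a + t * b))) volume 0 1 := by
  refine ContinuousOn.intervalIntegrable fun t ht => ContinuousAt.continuousWithinAt ?_
  rw [Set.uIcc_of_le zero_le_one] at ht
  have hne := (convexComb_pos ha hb ht).ne'
  fun_prop (disch := exact hne)

lemma integral_mul_sq_sub_div_convexComb {a b : ℝ} (ha : 0 < a) (hb : 0 < b) :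
    ∫ t in (0 : ℝ)..1, t * ((a - b) ^ 2 / ((1 - t) * a + t * b)) =
      a * Real.log (a / b) + (b - a) := by
  have hderiv : ∀ t ∈ Set.uIcc (0 : ℝ) 1,
      HasDerivAt (fun t : ℝ => t * (b - a) - a * Real.log ((1 - t) * a + t * b))
        (t * ((a - b) ^ 2 / ((1 - t) * a + t * b))) t := by
    intro t ht
    rw [Set.uIcc_of_le zero_le_one] at ht
    have hne := (convexComb_pos ha hb ht).ne'
    have hid := hasDerivAt_id' t
    have hlin := ((hid.const_sub 1).mul_const a).add (hid.mul_const b)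
    refine ((hid.mul_const (b - a)).sub ((hlin.log hne).const_mul a)).congr_deriv ?_
    simp only [Pi.add_apply]
    generalize hm : (1 - t) * a + t * b = m at hne ⊢
    field_simp
    rw [← hm]
    ring
  rw [intervalIntegral.integral_eq_sub_of_hasDerivAt hderiv
    (intervalIntegrable_mul_sq_sub_div_convexComb ha hb), Real.log_div ha.ne' hb.ne']
  simp
  ring

/-- Integral representation of the classical KL divergence:
`Σᵢ pᵢ log(pᵢ/qᵢ) = ∫₀¹ λ · χ²_λ(p‖q) dλ` with
`χ²_λ(p‖q) = Σᵢ (pᵢ−qᵢ)²/((1−λ)pᵢ + λqᵢ)`. -/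
theorem KL_integral_representation
    (n : ℕ) (hn : 0 < n)
    (p q : Fin n → ℝ)
    (hp : ∀ i, 0 < p i) (hq : ∀ i, 0 < q i)
    (hpsum : ∑ i, p i = 1) (hqsum : ∑ i, q i = 1) :
    ∑ i, p i * Real.log (p i / q i) =
      ∫ lam in (0:ℝ)..1,
        lam * ∑ i, (p i - q i) ^ 2 / ((1 - lam) * p i + lam * q i) := by
  simp_rw [Finset.mul_sum]
  rw [intervalIntegral.integral_finsetSum fun i _ =>
    intervalIntegrable_mul_sq_sub_div_convexComb (hp i) (hq i)]
  simp_rw [integral_mul_sq_sub_div_convexComb (hp _) (hq _)]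
  rw [Finset.sum_add_distrib, Finset.sum_sub_distrib, hpsum, hqsum, sub_self, add_zero]
end

section
/- Let n be a positive integer, let p, q : Fin n → ℝ be strictly positive probability vectors (p_i > 0, q_i > 0, Σᵢ p_i = Σᵢ q_i = 1), let X : Fin n → ℝ, and let λ ∈ (0,1). Set x := Σᵢ(p_i − q_i)X_i and assume (1−λ)Var_p(X) + λVar_q(X) + λ(1−λ)x² > 0. Then the tight classical Chapman–Robbins bound holds: Σᵢ (p_i − q_i)²/((1−λ)p_i + λq_i) ≥ x² / ((1−λ)Var_p(X) + λVar_q(X) + λ(1−λ)x²). -/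
/-- Variance of `X` under the probability vector `r`:
`Var_r(X) = Σᵢ rᵢ Xᵢ² − (Σᵢ rᵢ Xᵢ)²`. -/
noncomputable def varVec {n : ℕ} (r X : Fin n → ℝ) : ℝ :=
  (∑ i, r i * X i ^ 2) - (∑ i, r i * X i) ^ 2

/-- The variance of a probability vector is the mean squared deviation from its mean. -/
theorem varVec_eq_sum_sq_sub {n : ℕ} (r X : Fin n → ℝ) (hr : ∑ i, r i = 1) :
    varVec r X = ∑ i, r i * (X i - ∑ j, r j * X j) ^ 2 := by
  set c := ∑ j, r j * X j with hc
  have h : ∑ i, r i * (X i - c) ^ 2 =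
      ∑ i, r i * X i ^ 2 - 2 * c * ∑ i, r i * X i + c ^ 2 * ∑ i, r i := by
    simp only [Finset.mul_sum, ← Finset.sum_sub_distrib, ← Finset.sum_add_distrib]
    exact Finset.sum_congr rfl fun i _ => by ring
  rw [h, hr, varVec, ← hc]
  ring

/-- Variance of a mixture of two vectors. -/
theorem varVec_mixture {n : ℕ} (p q X : Fin n → ℝ) (t : ℝ) :
    varVec (fun i => (1 - t) * p i + t * q i) X =
      (1 - t) * varVec p X + t * varVec q X +
        t * (1 - t) * (∑ i, (p i - q i) * X i) ^ 2 := by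
  simp only [varVec, add_mul, sub_mul _ _ (X _), mul_assoc, Finset.sum_add_distrib,
    Finset.sum_sub_distrib, ← Finset.mul_sum]
  ring

/-- Cauchy–Schwarz: a signed vector `d` of total mass zero pairs with `X` to at most the product
of its weighted `χ²`-size and the variance of `X`. -/
theorem sq_sum_mul_le_sum_sq_div_mul_varVec {n : ℕ} (d m X : Fin n → ℝ)
    (hd : ∑ i, d i = 0) (hm : ∀ i, 0 < m i) (hmsum : ∑ i, m i = 1) :
    (∑ i, d i * X i) ^ 2 ≤ (∑ i, d i ^ 2 / m i) * varVec m X := by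
  rw [varVec_eq_sum_sq_sub m X hmsum]
  set c := ∑ j, m j * X j
  have hcenter : ∑ i, d i * X i = ∑ i, d i * (X i - c) := by
    simp only [mul_sub, Finset.sum_sub_distrib, ← Finset.sum_mul, hd, zero_mul, sub_zero]
  rw [hcenter]
  refine Finset.sum_sq_le_sum_mul_sum_of_sq_le_mul _
    (fun i _ => div_nonneg (sq_nonneg _) (hm i).le)
    (fun i _ => mul_nonneg (hm i).le (sq_nonneg _)) fun i _ => le_of_eq ?_
  have := (hm i).ne'
  field_simp

/-- Tight classical Chapman–Robbins bound:
`χ²_λ(p‖q) ≥ x² / ((1−λ)Var_p(X) + λVar_q(X) + λ(1−λ)x²)`. -/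
theorem classical_chapman_robbins
    (n : ℕ) (hn : 0 < n)
    (p q : Fin n → ℝ)
    (hp : ∀ i, 0 < p i) (hq : ∀ i, 0 < q i)
    (hpsum : ∑ i, p i = 1) (hqsum : ∑ i, q i = 1)
    (X : Fin n → ℝ)
    (lam : ℝ) (hlam : lam ∈ Set.Ioo (0:ℝ) 1)
    (x : ℝ) (hx : x = ∑ i, (p i - q i) * X i)
    (hden : 0 < (1 - lam) * varVec p X + lam * varVec q X + lam * (1 - lam) * x ^ 2) :
    ∑ i, (p i - q i) ^ 2 / ((1 - lam) * p i + lam * q i) ≥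
      x ^ 2 / ((1 - lam) * varVec p X + lam * varVec q X + lam * (1 - lam) * x ^ 2) := by
  obtain ⟨h0, h1⟩ := hlam
  have hd : ∑ i, (p i - q i) = 0 := by
    rw [Finset.sum_sub_distrib, hpsum, hqsum, sub_self]
  have hm : ∀ i, 0 < (1 - lam) * p i + lam * q i := fun i =>
    add_pos (mul_pos (sub_pos.2 h1) (hp i)) (mul_pos h0 (hq i))
  have hmsum : ∑ i, ((1 - lam) * p i + lam * q i) = 1 := by
    rw [Finset.sum_add_distrib, ← Finset.mul_sum, ← Finset.mul_sum, hpsum, hqsum]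
    ring
  have key := sq_sum_mul_le_sum_sq_div_mul_varVec (fun i => p i - q i) _ X hd hm hmsum
  rw [varVec_mixture, ← hx] at key
  exact (div_le_iff₀ hden).2 key
end

section
/- Let S and E be finite nonempty index types, let ρ'_{SE} be a positive definite Hermitian complex matrix indexed by S×E with unit trace, and let ρ_E be a positive definite Hermitian matrix indexed by E with unit trace. Define the partial traces ρ'_S (indexed by S) by (ρ'_S)_{s,s'} := Σ_e (ρ'_{SE})_{(s,e),(s',e)} and ρ'_E (indexed by E) by (ρ'_E)_{e,e'} := Σ_s (ρ'_{SE})_{(s,e),(s,e')}, and assume ρ'_S and ρ'_E are positive definite. Then the entropy production splits as D(ρ'_{SE} ‖ ρ'_S ⊗ ρ_E) = D(ρ'_{SE} ‖ ρ'_S ⊗ ρ'_E) + D(ρ'_E ‖ ρ_E), where ⊗ denotes the Kronecker product. -/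
open Matrix
open scoped ComplexOrder Kronecker

/-- The matrix logarithm can be computed in any unitary diagonalization with real spectrum. -/
theorem matLog_eq_of_unitary_diagonalization {n : Type*} [Fintype n] [DecidableEq n]
    {A U : Matrix n n ℂ} (hA : A.IsHermitian) (hU : star U * U = 1) (d : n → ℝ)
    (hAU : A * U = U * diagonal (fun i => (d i : ℂ))) :
    matLog A = U * diagonal (fun i => (Real.log (d i) : ℂ)) * star U := by
  set V : Matrix n n ℂ := (hA.eigenvectorUnitary : Matrix n n ℂ) with hV
  have hVV : star V * V = 1 := Unitary.coe_star_mul_self hA.eigenvectorUnitary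
  have hVV' : V * star V = 1 := mul_eq_one_comm.mp hVV
  have hUU' : U * star U = 1 := mul_eq_one_comm.mp hU
  have hspec : A = V * diagonal (fun i => (hA.eigenvalues i : ℂ)) * star V := by
    have h := hA.spectral_theorem
    rw [Unitary.conjStarAlgAut_apply] at h
    exact h
  have hintertwine : diagonal (fun i => (hA.eigenvalues i : ℂ)) * (star V * U) =
      (star V * U) * diagonal (fun i => (d i : ℂ)) := by
    calc diagonal (fun i => (hA.eigenvalues i : ℂ)) * (star V * U)
        = star V * V * diagonal (fun i => (hA.eigenvalues i : ℂ)) * star V * U := by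
          rw [hVV, one_mul, mul_assoc]
      _ = star V * (V * diagonal (fun i => (hA.eigenvalues i : ℂ)) * star V * U) := by
          simp only [mul_assoc]
      _ = star V * U * diagonal (fun i => (d i : ℂ)) := by
          rw [← hspec, hAU, mul_assoc]
  have hlog : diagonal (fun i => (Real.log (hA.eigenvalues i) : ℂ)) * (star V * U) =
      (star V * U) * diagonal (fun i => (Real.log (d i) : ℂ)) := by
    ext i j
    have hij := congrFun (congrFun hintertwine i) j
    rw [diagonal_mul, mul_diagonal, mul_comm] at hij
    rw [diagonal_mul, mul_diagonal, mul_comm]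
    by_cases hw : (star V * U) i j = 0
    · rw [hw, zero_mul, zero_mul]
    · rw [Complex.ofReal_inj.mp (mul_left_cancel₀ hw hij)]
  rw [matLog, dif_pos hA, ← hV]
  calc V * diagonal (fun i => (Real.log (hA.eigenvalues i) : ℂ)) * star V
      = V * (diagonal (fun i => (Real.log (hA.eigenvalues i) : ℂ)) * (star V * U)) * star U := by
        simp only [mul_assoc, hUU', mul_one]
    _ = V * star V * U * diagonal (fun i => (Real.log (d i) : ℂ)) * star U := by
        rw [hlog]; simp only [mul_assoc]
    _ = U * diagonal (fun i => (Real.log (d i) : ℂ)) * star U := by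
        rw [hVV', one_mul]

theorem matLog_kronecker {m n : Type*} [Fintype m] [DecidableEq m] [Fintype n] [DecidableEq n]
    {A : Matrix m m ℂ} {B : Matrix n n ℂ} (hA : A.PosDef) (hB : B.PosDef) :
    matLog (A ⊗ₖ B) = matLog A ⊗ₖ (1 : Matrix n n ℂ) + (1 : Matrix m m ℂ) ⊗ₖ matLog B := by
  have hAh := hA.isHermitian
  have hBh := hB.isHermitian
  set U : Matrix m m ℂ := (hAh.eigenvectorUnitary : Matrix m m ℂ) with hU
  set V : Matrix n n ℂ := (hBh.eigenvectorUnitary : Matrix n n ℂ) with hV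
  have hUU : star U * U = 1 := Unitary.coe_star_mul_self hAh.eigenvectorUnitary
  have hVV : star V * V = 1 := Unitary.coe_star_mul_self hBh.eigenvectorUnitary
  have hUU' : U * star U = 1 := mul_eq_one_comm.mp hUU
  have hVV' : V * star V = 1 := mul_eq_one_comm.mp hVV
  have hstar : star (U ⊗ₖ V) = star U ⊗ₖ star V := conjTranspose_kronecker U V
  have hAU : A * U = U * diagonal (fun i => (hAh.eigenvalues i : ℂ)) := by
    have h := hAh.spectral_theorem
    rw [Unitary.conjStarAlgAut_apply] at h
    calc A * U = U * diagonal (fun i => (hAh.eigenvalues i : ℂ)) * star U * U :=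
          congrArg (· * U) h
      _ = _ := by rw [mul_assoc, hUU, mul_one]
  have hBV : B * V = V * diagonal (fun i => (hBh.eigenvalues i : ℂ)) := by
    have h := hBh.spectral_theorem
    rw [Unitary.conjStarAlgAut_apply] at h
    calc B * V = V * diagonal (fun i => (hBh.eigenvalues i : ℂ)) * star V * V :=
          congrArg (· * V) h
      _ = _ := by rw [mul_assoc, hVV, mul_one]
  have hUV : star (U ⊗ₖ V) * (U ⊗ₖ V) = 1 := by
    rw [hstar, ← mul_kronecker_mul, hUU, hVV, one_kronecker_one]
  have hABh : (A ⊗ₖ B).IsHermitian := by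
    rw [IsHermitian, conjTranspose_kronecker, hAh.eq, hBh.eq]
  rw [matLog_eq_of_unitary_diagonalization hABh hUV
    (fun p => hAh.eigenvalues p.1 * hBh.eigenvalues p.2)]
  · have hdiag : diagonal (fun p : m × n =>
        (Real.log (hAh.eigenvalues p.1 * hBh.eigenvalues p.2) : ℂ)) =
        diagonal (fun i => (Real.log (hAh.eigenvalues i) : ℂ)) ⊗ₖ (1 : Matrix n n ℂ) +
        (1 : Matrix m m ℂ) ⊗ₖ diagonal (fun i => (Real.log (hBh.eigenvalues i) : ℂ)) := by
      rw [← diagonal_one, ← diagonal_one, diagonal_kronecker_diagonal,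
        diagonal_kronecker_diagonal, diagonal_add]
      congr 1
      funext p
      rw [Real.log_mul (hA.eigenvalues_pos p.1).ne' (hB.eigenvalues_pos p.2).ne']
      push_cast
      ring
    rw [hdiag, hstar, mul_add, add_mul, ← mul_kronecker_mul, ← mul_kronecker_mul,
      ← mul_kronecker_mul, ← mul_kronecker_mul, mul_one, mul_one, hUU', hVV',
      matLog, dif_pos hAh, matLog, dif_pos hBh]
  · rw [← mul_kronecker_mul, hAU, hBV, mul_kronecker_mul, diagonal_kronecker_diagonal]
    push_cast
    rfl

theorem trace_mul_one_kronecker {m n R : Type*} [Fintype m] [DecidableEq m] [Fintype n]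
    [CommSemiring R] (ρ : Matrix (m × n) (m × n) R) (M : Matrix n n R) :
    (ρ * ((1 : Matrix m m R) ⊗ₖ M)).trace =
      ((Matrix.of fun e e' => ∑ s, ρ (s, e) (s, e')) * M).trace := by
  simp only [trace, diag_apply, mul_apply, kroneckerMap_apply, Fintype.sum_prod_type, of_apply,
    one_apply, ite_mul, one_mul, zero_mul, mul_ite, mul_zero, Finset.sum_mul]
  rw [Finset.sum_comm]
  refine Finset.sum_congr rfl fun e _ => ?_
  rw [Finset.sum_comm (s := (Finset.univ : Finset n))]
  refine Finset.sum_congr rfl fun s _ => ?_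
  rw [Finset.sum_comm]
  simp

/-- Entropy-production splitting:
`D(ρ'_{SE} ‖ ρ'_S ⊗ ρ_E) = D(ρ'_{SE} ‖ ρ'_S ⊗ ρ'_E) + D(ρ'_E ‖ ρ_E)`,
where `ρ'_S` and `ρ'_E` are the partial traces of `ρ'_{SE}`. -/
theorem entropy_production_splitting
    (S E : Type*) [Fintype S] [DecidableEq S] [Nonempty S]
    [Fintype E] [DecidableEq E] [Nonempty E]
    (ρSE' : Matrix (S × E) (S × E) ℂ)
    (hρSE' : ρSE'.PosDef) (hρSE'tr : ρSE'.trace = 1)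
    (ρE : Matrix E E ℂ) (hρE : ρE.PosDef) (hρEtr : ρE.trace = 1)
    (ρS' : Matrix S S ℂ)
    (hρS' : ρS' = Matrix.of fun s s' => ∑ e, ρSE' (s, e) (s', e))
    (ρE' : Matrix E E ℂ)
    (hρE' : ρE' = Matrix.of fun e e' => ∑ s, ρSE' (s, e) (s, e'))
    (hρS'pd : ρS'.PosDef) (hρE'pd : ρE'.PosDef) :
    qRelEnt ρSE' (ρS' ⊗ₖ ρE) = qRelEnt ρSE' (ρS' ⊗ₖ ρE') + qRelEnt ρE' ρE := by
  have htr (M : Matrix E E ℂ) : (ρSE' * ((1 : Matrix S S ℂ) ⊗ₖ M)).trace = (ρE' * M).trace := by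
    rw [hρE', trace_mul_one_kronecker]
  simp only [qRelEnt, matLog_kronecker hρS'pd hρE, matLog_kronecker hρS'pd hρE'pd, mul_sub,
    mul_add, trace_sub, trace_add, htr, Complex.sub_re, Complex.add_re]
  ring
end
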